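/- arXiv:2407.16861 — 3 statements merged into one kernel-verified Lean document; each statement's English description precedes it below -/
import Mathlib

section
/- For every symplectic automorphism psi in Sp(V, omega) there exists a symplectic automorphism phi in Sp(V', omega') lifting it, i.e. such that the mod-d reduction of phi(v) equals psi applied to the mod-d reduction of v for all v in V'. Equivalently, in matrix form: for every 2n-by-2n matrix Psi over ZMod d satisfying Psi^T * Omega * Psi = Omega (where Omega is the Gram matrix of omega in the standard basis), there exists a 2n-by-2n matrix Phi over ZMod d' satisfying Phi^T * Omega' * Phi = Omega' (Omega' the Gram matrix of omega') whose entrywise image under the natural ring homomorphism ZMod d' -> ZMod d equals Psi. -/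
noncomputable section

namespace PaperPCl

/-- `d' = 2d` if `d` is even, `d' = d` if `d` is odd. -/
def dp (d : ℕ) : ℕ := if Even d then 2 * d else d

lemma d_dvd_dp (d : ℕ) : d ∣ dp d := by
  unfold dp; split
  · exact dvd_mul_left d 2
  · rfl

/-- The phase space `V = (ZMod d)^n × (ZMod d)^n`, vectors written `(q, p)`. -/
abbrev V (d n : ℕ) := (Fin n → ZMod d) × (Fin n → ZMod d)

/-- Dot product of two vectors in `(ZMod d)^n`. -/
def dotp {d n : ℕ} (p q : Fin n → ZMod d) : ZMod d := ∑ i, p i * q i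

/-- The standard symplectic form `omega((q1,p1),(q2,p2)) = p1·q2 - p2·q1`. -/
def omegaF {d n : ℕ} (v w : V d n) : ZMod d := dotp v.2 w.1 - dotp w.2 v.1

/-- Componentwise reduction mod `d`, `V' → V`. -/
def reduceV (d n : ℕ) (v : V (dp d) n) : V d n :=
  (fun i => ZMod.castHom (d_dvd_dp d) (ZMod d) (v.1 i),
   fun i => ZMod.castHom (d_dvd_dp d) (ZMod d) (v.2 i))

/-- Componentwise `val`-lift `V → V'`. -/
def liftV (d n : ℕ) (u : V d n) : V (dp d) n :=
  (fun i => ((u.1 i).val : ZMod (dp d)), fun i => ((u.2 i).val : ZMod (dp d)))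

/-- `zeta = exp(2 pi i / d)`. -/
def zeta (d : ℕ) : ℂ := Complex.exp (2 * Real.pi * Complex.I / d)

/-- `tau = exp(pi i / d)` if `d` is even, `tau = zeta^((d+1)/2)` if `d` is odd. -/
def tau (d : ℕ) : ℂ :=
  if Even d then Complex.exp (Real.pi * Complex.I / d) else zeta d ^ ((d + 1) / 2)

/-- The Pauli matrix `D_(q,p) = X^q Z^p`, a `d^n × d^n` complex matrix. -/
def Dop (d n : ℕ) [NeZero d] (u : V d n) : Matrix (Fin n → ZMod d) (Fin n → ZMod d) ℂ :=
  fun r s => if r = s + u.1 then zeta d ^ (dotp u.2 s).val else 0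

/-- The displacement operator `Delta_v = tau^(q·p) D_(vbar)` for `v = (q,p) ∈ V'`. -/
def Delta (d n : ℕ) [NeZero d] (v : V (dp d) n) : Matrix (Fin n → ZMod d) (Fin n → ZMod d) ℂ :=
  tau d ^ (dotp v.1 v.2).val • Dop d n (reduceV d n v)

/-- The large Pauli group `P'`: the subgroup of invertible `d^n × d^n` complex matrices
generated by the scalar matrix `tau • 1` together with all `D_u`, `u ∈ V`. -/
def Pgrp (d n : ℕ) [NeZero d] : Subgroup (Matrix (Fin n → ZMod d) (Fin n → ZMod d) ℂ)ˣ :=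
  Subgroup.closure {x | (x : Matrix (Fin n → ZMod d) (Fin n → ZMod d) ℂ)
      = tau d • (1 : Matrix (Fin n → ZMod d) (Fin n → ZMod d) ℂ)
    ∨ ∃ u : V d n, (x : Matrix (Fin n → ZMod d) (Fin n → ZMod d) ℂ) = Dop d n u}

/-- The underlying matrix of an element of `P'`. -/
def matVal {d n : ℕ} [NeZero d] (g : ↥(Pgrp d n)) : Matrix (Fin n → ZMod d) (Fin n → ZMod d) ℂ :=
  ((g : (Matrix (Fin n → ZMod d) (Fin n → ZMod d) ℂ)ˣ) : Matrix (Fin n → ZMod d) (Fin n → ZMod d) ℂ)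

/-- A function `γ : P' → P'` is center-respecting if `γ(z*g) = z*γ(g)`
for every `z` in the center of `P'`. -/
def CenterResp {d n : ℕ} [NeZero d] (γ : ↥(Pgrp d n) → ↥(Pgrp d n)) : Prop :=
  ∀ z ∈ Subgroup.center ↥(Pgrp d n), ∀ g, γ (z * g) = z * γ g

/-- A group automorphism of `P'` is projective Clifford if it fixes the center pointwise. -/
def IsPCl {d n : ℕ} [NeZero d] (γ : ↥(Pgrp d n) ≃* ↥(Pgrp d n)) : Prop :=
  ∀ z ∈ Subgroup.center ↥(Pgrp d n), γ z = z

/-- A linear automorphism is symplectic if it preserves the standard symplectic form. -/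
def IsSymp (d n : ℕ) (ψ : V d n ≃ₗ[ZMod d] V d n) : Prop :=
  ∀ u v : V d n, omegaF (ψ u) (ψ v) = omegaF u v

/-- `b` is a standard basis vector of `V`. -/
def IsStdBasis {d n : ℕ} (b : V d n) : Prop :=
  (∃ i : Fin n, b = (Pi.single i 1, 0)) ∨ (∃ i : Fin n, b = (0, Pi.single i 1))

open scoped Matrix

/-- Over a finite index type, a matrix with zero diagonal and `Bᵀ = -B` is `U - Uᵀ` for
some `U`, each of whose entries is an entry of `B` or zero. -/
lemma exists_eq_sub_transpose {m R : Type*} [Fintype m] [CommRing R] (B : Matrix m m R)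
    (hdiag : ∀ i, B i i = 0) (hskew : Bᵀ = -B) :
    ∃ U : Matrix m m R, B = U - Uᵀ ∧ ∀ i j, U i j = B i j ∨ U i j = 0 := by
  classical
  let e := Fintype.equivFin m
  refine ⟨Matrix.of fun i j => if e i < e j then B i j else 0, ?_, fun i j => ?_⟩
  · ext i j
    have h : B j i = -B i j := congrFun (congrFun hskew i) j
    simp only [Matrix.sub_apply, Matrix.transpose_apply, Matrix.of_apply]
    rcases lt_trichotomy (e i) (e j) with hij | hij | hij
    · simp [hij, hij.not_gt]
    · obtain rfl := e.injective hij
      simp [hdiag]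
    · simp [hij, hij.not_gt, h]
  · by_cases hij : e i < e j <;> simp [hij]

lemma dotProduct_J_mulVec {l R : Type*} [Fintype l] [DecidableEq l] [CommRing R]
    (x y : l ⊕ l → R) :
    x ⬝ᵥ (Matrix.J l R) *ᵥ y =
      (∑ i, x (Sum.inr i) * y (Sum.inl i)) - ∑ i, y (Sum.inr i) * x (Sum.inl i) := by
  simp [Matrix.J, Matrix.fromBlocks_mulVec, dotProduct, Fintype.sum_sum_type, Matrix.neg_mulVec,
    mul_comm, neg_add_eq_sub]

lemma transpose_mul_J_mul_apply {l R : Type*} [Fintype l] [DecidableEq l] [CommRing R]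
    (M : Matrix (l ⊕ l) (l ⊕ l) R) (i j : l ⊕ l) :
    (Mᵀ * Matrix.J l R * M) i j = M.col i ⬝ᵥ (Matrix.J l R) *ᵥ M.col j := by
  rw [Matrix.mul_assoc, Matrix.mul_apply]
  rfl

/-- Symplectic matrices lift along surjective ring homomorphisms whose kernel has square zero. -/
lemma exists_symplectic_lift_of_ker_mul_ker {l R S : Type*} [Fintype l] [DecidableEq l]
    [CommRing R] [CommRing S] (f : R →+* S) (hf : Function.Surjective f)
    (hker : ∀ x y, f x = 0 → f y = 0 → x * y = 0)
    (A : Matrix (l ⊕ l) (l ⊕ l) S) (hA : Aᵀ * Matrix.J l S * A = Matrix.J l S) :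
    ∃ B : Matrix (l ⊕ l) (l ⊕ l) R,
      Bᵀ * Matrix.J l R * B = Matrix.J l R ∧ B.map f = A := by
  choose g hg using hf
  let J := Matrix.J l R
  let M : Matrix (l ⊕ l) (l ⊕ l) R := A.map g
  have hM : M.map f = A := by ext i j; simp [M, hg]
  have hmul : ∀ P Q : Matrix (l ⊕ l) (l ⊕ l) R, P.map f = 0 → Q.map f = 0 → P * Q = 0 := by
    intro P Q hP hQ
    ext i j
    exact Finset.sum_eq_zero fun k _ =>
      hker _ _ (congrFun (congrFun hP i) k) (congrFun (congrFun hQ k) j)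
  have hJT : Jᵀ = -J := Matrix.J_transpose l R
  have hJJ : J * J = -1 := Matrix.J_squared l R
  let E := Mᵀ * J * M - J
  have hE : E.map f = 0 := by
    rw [Matrix.map_sub _ (map_sub f), Matrix.map_mul, Matrix.map_mul, Matrix.transpose_map, hM,
      Matrix.map_J, hA, sub_self]
  obtain ⟨U, hU, hUE⟩ := exists_eq_sub_transpose E
    (fun i => by
      have h₁ : (Mᵀ * J * M) i i = 0 := by
        rw [transpose_mul_J_mul_apply, dotProduct_J_mulVec, sub_self]
      have h₂ : J i i = 0 := by rcases i with i | i <;> simp [J, Matrix.J]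
      simp only [E, Matrix.sub_apply, h₁, h₂, sub_self])
    (by simp only [E, Matrix.transpose_sub, Matrix.transpose_mul, Matrix.transpose_transpose, hJT,
          Matrix.mul_neg, Matrix.neg_mul, Matrix.mul_assoc]
        abel)
  have hUf : U.map f = 0 := by
    ext i j
    rcases hUE i j with h | h
    · simpa [h] using congrFun (congrFun hE i) j
    · simp [h]
  let Z := J * U
  have hZ : Z.map f = 0 := by rw [Matrix.map_mul, hUf, Matrix.mul_zero]
  have hZT : Zᵀ.map f = 0 := by rw [Matrix.transpose_map, hZ, Matrix.transpose_zero]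
  have hJZ : J * Z = -U := by rw [← Matrix.mul_assoc, hJJ, Matrix.neg_mul, Matrix.one_mul]
  have hZJ : Zᵀ * J = Uᵀ := by
    rw [Matrix.transpose_mul, hJT, Matrix.mul_assoc, Matrix.neg_mul, hJJ, neg_neg, Matrix.mul_one]
  refine ⟨M * (1 + Z), ?_, ?_⟩
  · have hMJ : Mᵀ * J * M = J + E := by simp [E]
    calc (M * (1 + Z))ᵀ * J * (M * (1 + Z))
        = (1 + Zᵀ) * (Mᵀ * J * M) * (1 + Z) := by
          simp only [Matrix.transpose_mul, Matrix.transpose_add, Matrix.transpose_one,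
            Matrix.mul_assoc]
      _ = J + E + J * Z + E * Z + Zᵀ * J + Zᵀ * E + (Zᵀ * J) * Z + (Zᵀ * E) * Z := by
          rw [hMJ]; noncomm_ring
      _ = J := by
          have hUT : Uᵀ.map f = 0 := by rw [Matrix.transpose_map, hUf, Matrix.transpose_zero]
          rw [hJZ, hZJ, hmul E Z hE hZ, hmul _ E hZT hE, hmul _ Z hUT hZ, Matrix.zero_mul, hU]
          abel
  · rw [Matrix.map_mul, Matrix.map_add _ (map_add f), hZ, hM,
      Matrix.map_one _ (map_zero f) (map_one f), add_zero, Matrix.mul_one]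

lemma dp_dvd_mul_self (d : ℕ) : dp d ∣ d * d := by
  unfold dp
  split_ifs with h
  · exact Nat.mul_dvd_mul_right h.two_dvd d
  · exact dvd_mul_left d d

lemma mul_eq_zero_of_castHom_eq_zero {d : ℕ} (x y : ZMod (dp d))
    (hx : ZMod.castHom (d_dvd_dp d) (ZMod d) x = 0)
    (hy : ZMod.castHom (d_dvd_dp d) (ZMod d) y = 0) : x * y = 0 := by
  obtain ⟨a, rfl⟩ := ZMod.intCast_surjective x
  obtain ⟨b, rfl⟩ := ZMod.intCast_surjective y
  rw [map_intCast, ZMod.intCast_zmod_eq_zero_iff_dvd] at hx hy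
  rw [← Int.cast_mul, ZMod.intCast_zmod_eq_zero_iff_dvd]
  exact (by exact_mod_cast dp_dvd_mul_self d : (dp d : ℤ) ∣ d * d).trans (mul_dvd_mul hx hy)

/-- The identification of coordinate vectors indexed by `Fin n ⊕ Fin n` with `V d n`. -/
def coordEquiv (d n : ℕ) : (Fin n ⊕ Fin n → ZMod d) ≃ₗ[ZMod d] V d n :=
  LinearEquiv.sumArrowLequivProdArrow (Fin n) (Fin n) (ZMod d) (ZMod d)

lemma omegaF_coordEquiv {d n : ℕ} (x y : Fin n ⊕ Fin n → ZMod d) :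
    omegaF (coordEquiv d n x) (coordEquiv d n y) = x ⬝ᵥ (Matrix.J (Fin n) (ZMod d)) *ᵥ y := by
  rw [dotProduct_J_mulVec]
  rfl

lemma reduceV_coordEquiv {d n : ℕ} (x : Fin n ⊕ Fin n → ZMod (dp d)) :
    reduceV d n (coordEquiv (dp d) n x) =
      coordEquiv d n (ZMod.castHom (d_dvd_dp d) (ZMod d) ∘ x) :=
  rfl

lemma mulVec_dotProduct_J_mulVec_mulVec {l R : Type*} [Fintype l] [DecidableEq l] [CommRing R]
    (M : Matrix (l ⊕ l) (l ⊕ l) R) (x y : l ⊕ l → R) :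
    (M *ᵥ x) ⬝ᵥ (Matrix.J l R) *ᵥ (M *ᵥ y) = x ⬝ᵥ (Mᵀ * Matrix.J l R * M) *ᵥ y := by
  rw [← Matrix.mulVec_mulVec, ← Matrix.mulVec_mulVec, Matrix.dotProduct_mulVec x,
    Matrix.vecMul_transpose]

theorem symplectic_lift (d n : ℕ) (hd : 2 ≤ d) (hn : 1 ≤ n)
    (ψ : V d n ≃ₗ[ZMod d] V d n) (hψ : IsSymp d n ψ) :
    ∃ φ : V (dp d) n ≃ₗ[ZMod (dp d)] V (dp d) n,
      IsSymp (dp d) n φ ∧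
      ∀ v : V (dp d) n, reduceV d n (φ v) = ψ (reduceV d n v) := by
  let A := LinearMap.toMatrix' ((coordEquiv d n).symm.toLinearMap ∘ₗ ψ.toLinearMap ∘ₗ
    (coordEquiv d n).toLinearMap)
  have hAψ (x : Fin n ⊕ Fin n → ZMod d) :
      coordEquiv d n (A *ᵥ x) = ψ (coordEquiv d n x) := by
    simp [A, LinearMap.toMatrix'_mulVec]
  have hA : Aᵀ * Matrix.J (Fin n) (ZMod d) * A = Matrix.J (Fin n) (ZMod d) := by
    refine Matrix.ext_of_single_vecMul fun i => funext fun j => ?_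
    have h := hψ (coordEquiv d n (Pi.single i 1)) (coordEquiv d n (Pi.single j 1))
    rw [← hAψ, ← hAψ, omegaF_coordEquiv, omegaF_coordEquiv,
      mulVec_dotProduct_J_mulVec_mulVec] at h
    simpa using h
  obtain ⟨B, hB, hBA⟩ := exists_symplectic_lift_of_ker_mul_ker
    (ZMod.castHom (d_dvd_dp d) (ZMod d)) (ZMod.castHom_surjective _)
    mul_eq_zero_of_castHom_eq_zero A hA
  have hinv : (-(Matrix.J (Fin n) (ZMod (dp d)) * Bᵀ * Matrix.J (Fin n) (ZMod (dp d)))) * B = 1 := by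
    rw [Matrix.neg_mul, Matrix.mul_assoc, Matrix.mul_assoc, ← Matrix.mul_assoc Bᵀ, hB,
      Matrix.J_squared, neg_neg]
  let β := Matrix.toLin'OfInv hinv (mul_eq_one_comm.mp hinv)
  refine ⟨(coordEquiv (dp d) n).symm.trans (β.trans (coordEquiv (dp d) n)), ?_, ?_⟩
  all_goals have hβ (x) : β x = B *ᵥ x := rfl
  · intro u v
    obtain ⟨x, rfl⟩ := (coordEquiv (dp d) n).surjective u
    obtain ⟨y, rfl⟩ := (coordEquiv (dp d) n).surjective v
    simp only [LinearEquiv.trans_apply, LinearEquiv.symm_apply_apply, hβ, omegaF_coordEquiv,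
      mulVec_dotProduct_J_mulVec_mulVec, hB]
  · intro v
    obtain ⟨x, rfl⟩ := (coordEquiv (dp d) n).surjective v
    simp only [LinearEquiv.trans_apply, LinearEquiv.symm_apply_apply, hβ, reduceV_coordEquiv,
      ← hAψ, ← hBA]
    congr 1
    ext i
    exact RingHom.map_mulVec _ B x i

end PaperPCl
end
end

section
/- Let gamma be an element of PCl' and suppose t : V' -> ZMod d' and phi : V' -> V' are functions satisfying gamma(Delta_v) = tau^((t v).val) * Delta_(phi v) for all v in V'. Then d * t(v) = 0 in ZMod d' for every v in V'; that is, each phase tau^(t v) is a power of zeta (equivalently, when d is even every value t(v) is an even element of ZMod (2d)). -/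
noncomputable section

namespace PaperPCl

/-- For even `d`, `tau d` is a primitive root of unity of order `dp d = 2 * d`. -/
lemma isPrimitiveRoot_tau {d : ℕ} (hd : d ≠ 0) (he : Even d) :
    IsPrimitiveRoot (tau d) (2 * d) := by
  have h := Complex.isPrimitiveRoot_exp (2 * d) (by omega)
  have hd' : (d : ℂ) ≠ 0 := by exact_mod_cast hd
  convert h using 1
  rw [tau, if_pos he]
  congr 1
  push_cast
  field_simp

lemma tau_sq {d : ℕ} (he : Even d) : tau d ^ 2 = zeta d := by
  rw [tau, if_pos he, zeta, ← Complex.exp_nat_mul]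
  congr 1
  push_cast
  ring

lemma zeta_pow_self (d : ℕ) [NeZero d] : zeta d ^ d = 1 :=
  (Complex.isPrimitiveRoot_exp d (NeZero.ne d)).pow_eq_one

lemma zeta_pow_val_natCast (d : ℕ) [NeZero d] (m : ℕ) :
    zeta d ^ (m : ZMod d).val = zeta d ^ m := by
  rw [ZMod.val_natCast, ← pow_eq_pow_mod m (zeta_pow_self d)]

lemma zeta_pow_val_add (d : ℕ) [NeZero d] (a b : ZMod d) :
    zeta d ^ (a + b).val = zeta d ^ a.val * zeta d ^ b.val := by
  rw [← pow_add, ← zeta_pow_val_natCast d (a.val + b.val)]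
  simp

lemma dotp_add_right {d n : ℕ} (p q r : Fin n → ZMod d) :
    dotp p (q + r) = dotp p q + dotp p r := by
  simp [dotp, mul_add, Finset.sum_add_distrib]

lemma dotp_comm {d n : ℕ} (p q : Fin n → ZMod d) : dotp p q = dotp q p := by
  simp [dotp, mul_comm]

lemma dotp_reduceV (d n : ℕ) (v : V (dp d) n) :
    dotp (reduceV d n v).1 (reduceV d n v).2
      = ZMod.castHom (d_dvd_dp d) (ZMod d) (dotp v.1 v.2) := by
  simp only [dotp, reduceV, map_sum, map_mul]

/-- The entries of the powers of a Pauli matrix. -/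
lemma Dop_pow_apply (d n : ℕ) [NeZero d] (u : V d n) (k : ℕ) (r s : Fin n → ZMod d) :
    (Dop d n u ^ k) r s = if r = s + k • u.1 then
      (zeta d ^ (dotp u.2 s).val) ^ k * (zeta d ^ (dotp u.2 u.1).val) ^ k.choose 2 else 0 := by
  induction k generalizing r s with
  | zero => simp [Matrix.one_apply]
  | succ k ih =>
    rw [pow_succ, Matrix.mul_apply, Finset.sum_eq_single (s + u.1)]
    · have hs : s + u.1 + k • u.1 = s + (k + 1) • u.1 := by rw [succ_nsmul']; abel
      rw [ih, hs]
      split_ifs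
      · rw [Dop, if_pos rfl, dotp_add_right, zeta_pow_val_add, Nat.choose_succ_succ' k 1,
          Nat.choose_one_right]
        ring
      · simp
    · intro j _ hj
      simp [Dop, hj]
    · simp

/-- The `d`-th power of a Pauli matrix is scalar. -/
lemma Dop_pow_self (d n : ℕ) [NeZero d] (u : V d n) :
    Dop d n u ^ d = (zeta d ^ (dotp u.1 u.2).val) ^ d.choose 2 • 1 := by
  ext r s
  have hz : d • u.1 = 0 := by ext i; simp
  have ho (m : ℕ) : (zeta d ^ m) ^ d = 1 := by rw [pow_right_comm, zeta_pow_self, one_pow]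
  rw [Dop_pow_apply, hz, ho, dotp_comm]
  simp [Matrix.one_apply]

/-- For even `d`, every displacement operator has order dividing `d`. -/
lemma Delta_pow_self (d n : ℕ) [NeZero d] (he : Even d) (v : V (dp d) n) :
    Delta d n v ^ d = 1 := by
  have : NeZero (dp d) := ⟨by have := NeZero.ne d; rw [dp, if_pos he]; omega⟩
  obtain ⟨c, hc⟩ := he.two_dvd
  set x := dotp v.1 v.2 with hx
  have hcast : ZMod.castHom (d_dvd_dp d) (ZMod d) x = (x.val : ZMod d) := by
    rw [ZMod.castHom_apply, ZMod.natCast_val]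
  have hexp : x.val * d + 2 * (x.val * d.choose 2) = 2 * d * (x.val * c) := by
    have h2 : 2 * d.choose 2 = d * (d - 1) := by
      rw [Nat.choose_two_right, Nat.mul_div_cancel' (Nat.even_mul_pred_self d).two_dvd]
    have h3 : d + d * (d - 1) = d * d := by
      obtain ⟨m, hm⟩ := Nat.exists_eq_succ_of_ne_zero (NeZero.ne d)
      rw [hm, Nat.succ_eq_add_one, Nat.add_sub_cancel]; ring
    calc x.val * d + 2 * (x.val * d.choose 2) = x.val * (d + 2 * d.choose 2) := by ring
      _ = x.val * (d * (2 * c)) := by rw [h2, h3, ← hc]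
      _ = _ := by ring
  rw [Delta, ← hx, smul_pow, Dop_pow_self, dotp_reduceV, ← hx, hcast, zeta_pow_val_natCast,
    smul_smul, ← tau_sq he, ← pow_mul, ← pow_mul, ← pow_mul, ← pow_add, hexp, pow_mul,
    (isPrimitiveRoot_tau (NeZero.ne d) he).pow_eq_one, one_pow, one_smul]

/-- Every Pauli matrix is invertible. -/
lemma isUnit_Dop (d n : ℕ) [NeZero d] (u : V d n) : IsUnit (Dop d n u) := by
  refine IsUnit.of_pow_eq_one (n := d * d) ?_ (mul_ne_zero (NeZero.ne d) (NeZero.ne d))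
  rw [pow_mul, Dop_pow_self, smul_pow, one_pow, pow_right_comm, pow_right_comm _ _ d,
    zeta_pow_self, one_pow, one_pow, one_smul]

/-- For even `d`, every displacement operator lies in the large Pauli group. -/
lemma exists_matVal_eq_Delta (d n : ℕ) [NeZero d] (he : Even d) (v : V (dp d) n) :
    ∃ g : Pgrp d n, matVal g = Delta d n v := by
  have htau : IsUnit (tau d • (1 : Matrix (Fin n → ZMod d) (Fin n → ZMod d) ℂ)) := by
    have hd : 2 * d ≠ 0 := by simp [NeZero.ne d]
    refine IsUnit.of_pow_eq_one (n := 2 * d) ?_ hd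
    rw [smul_pow, (isPrimitiveRoot_tau (NeZero.ne d) he).pow_eq_one, one_pow, one_smul]
  obtain ⟨z, hz⟩ := htau
  obtain ⟨x, hx⟩ := isUnit_Dop d n (reduceV d n v)
  refine ⟨⟨z ^ (dotp v.1 v.2).val * x, (Pgrp d n).mul_mem
    ((Pgrp d n).pow_mem (Subgroup.subset_closure (Or.inl hz)) _)
    (Subgroup.subset_closure (Or.inr ⟨_, hx⟩))⟩, ?_⟩
  simp [matVal, hz, hx, Delta, smul_pow]

theorem lambda_codomain (d n : ℕ) [NeZero d] (hd : 2 ≤ d) (hn : 1 ≤ n)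
    (γ : ↥(Pgrp d n) ≃* ↥(Pgrp d n)) (hγ : IsPCl γ)
    (t : V (dp d) n → ZMod (dp d)) (φ : V (dp d) n → V (dp d) n)
    (h : ∀ v : V (dp d) n, ∀ g : ↥(Pgrp d n), matVal g = Delta d n v →
        matVal (γ g) = tau d ^ (t v).val • Delta d n (φ v)) :
    ∀ v : V (dp d) n, (d : ZMod (dp d)) * t v = 0 := by
  intro v
  rcases Nat.even_or_odd d with he | ho
  · have hdp : dp d = 2 * d := if_pos he
    have : NeZero (dp d) := ⟨by omega⟩
    obtain ⟨g, hg⟩ := exists_matVal_eq_Delta d n he v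
    have hpow (a : Pgrp d n) (k : ℕ) : matVal (a ^ k) = matVal a ^ k := by simp [matVal]
    have hg1 : g ^ d = 1 := by
      apply Subtype.ext
      apply Units.ext
      change matVal (g ^ d) = 1
      rw [hpow, hg, Delta_pow_self d n he]
    have h1 : matVal (γ g ^ d) = 1 := by rw [← map_pow, hg1, map_one]; rfl
    rw [hpow, h v g hg, smul_pow, Delta_pow_self d n he, ← pow_mul] at h1
    have h2 : tau d ^ ((t v).val * d) = 1 := by
      simpa using congrFun (congrFun h1 0) 0
    have h3 := (isPrimitiveRoot_tau (NeZero.ne d) he).dvd_of_pow_eq_one _ h2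
    rw [← hdp, ← ZMod.natCast_eq_zero_iff, Nat.cast_mul, ZMod.natCast_zmod_val] at h3
    rw [mul_comm, h3]
  · have hdp : d = dp d := (if_neg (Nat.not_even_iff_odd.mpr ho)).symm
    have hz : (d : ZMod (dp d)) = 0 := (ZMod.natCast_eq_zero_iff _ _).mpr hdp.symm.dvd
    rw [hz, zero_mul]

end PaperPCl
end
end

section
/- Let lambda0 : V' -> ZMod d' and phi0 : V' -> V' be functions such that the composite map v -> (phi0 v)bar from V' to V is additive. Then there exist a function lambda : V' -> ZMod d' and a ZMod d'-linear map phi : V' -> V' such that tau^((lambda0 v).val) * Delta_(phi0 v) = tau^((lambda v).val) * Delta_(phi v) for all v in V' (i.e. (lambda0, phi0) and (lambda, phi) define the same relation, so every pre-Delta-encoding whose reduced output map is linear is equivalent to a linear pre-Delta-encoding). -/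
noncomputable section

namespace PaperPCl

lemma dp_ne_zero (d : ℕ) [NeZero d] : dp d ≠ 0 := by
  unfold dp
  have := NeZero.ne d
  split <;> omega

instance (d : ℕ) [NeZero d] : NeZero (dp d) := ⟨dp_ne_zero d⟩

lemma tau_pow_dp (d : ℕ) [NeZero d] : tau d ^ dp d = 1 := by
  unfold tau dp
  split
  · have hd : (d : ℂ) ≠ 0 := Nat.cast_ne_zero.mpr (NeZero.ne d)
    rw [← Complex.exp_nat_mul, ← Complex.exp_two_pi_mul_I]
    congr 1
    push_cast
    field_simp
  · rw [← pow_mul, mul_comm, pow_mul, zeta_pow_self, one_pow]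

lemma tau_pow_val_add (d : ℕ) [NeZero d] (a b : ZMod (dp d)) :
    tau d ^ (a + b).val = tau d ^ a.val * tau d ^ b.val := by
  rw [ZMod.val_add, ← pow_add, ← pow_eq_pow_mod _ (tau_pow_dp d)]

/-- Reduction mod `d` as an additive homomorphism. -/
def reduceHom (d n : ℕ) : V (dp d) n →+ V d n where
  toFun := reduceV d n
  map_zero' := by ext i <;> simp [reduceV]
  map_add' v w := Prod.ext (funext fun _ => map_add _ _ _) (funext fun _ => map_add _ _ _)

/-- Additive maps out of a `ZMod m`-module are determined by their values on a basis. -/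
lemma addMonoidHom_eq_of_basis {m : ℕ} [NeZero m] {ι M N : Type*} [Fintype ι]
    [AddCommGroup M] [Module (ZMod m) M] [AddCommGroup N] (b : Module.Basis ι (ZMod m) M)
    {f g : M →+ N} (h : ∀ i, f (b i) = g (b i)) : f = g := by
  ext v
  have hsmul (c : ZMod m) (x : M) : c • x = c.val • x := by
    rw [← Nat.cast_smul_eq_nsmul (ZMod m), ZMod.natCast_zmod_val]
  rw [← b.sum_repr v]
  simp only [hsmul, map_sum, map_nsmul, h]

/-- A map whose reduction mod `d` is additive agrees mod `d` with a linear map. -/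
lemma exists_linearMap_reduceV_eq (d n : ℕ) [NeZero d] (φ0 : V (dp d) n → V (dp d) n)
    (hadd : ∀ v w : V (dp d) n,
      reduceV d n (φ0 (v + w)) = reduceV d n (φ0 v) + reduceV d n (φ0 w)) :
    ∃ φ : V (dp d) n →ₗ[ZMod (dp d)] V (dp d) n,
      ∀ v, reduceV d n (φ0 v) = reduceV d n (φ v) := by
  let b := (Pi.basisFun (ZMod (dp d)) (Fin n)).prod (Pi.basisFun (ZMod (dp d)) (Fin n))
  let φ := b.constr (ZMod (dp d)) fun i => φ0 (b i)
  have h : AddMonoidHom.mk' (fun v => reduceV d n (φ0 v)) hadd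
      = (reduceHom d n).comp φ.toAddMonoidHom :=
    addMonoidHom_eq_of_basis b fun i =>
      congrArg (reduceV d n) (b.constr_basis (ZMod (dp d)) (fun i => φ0 (b i)) i).symm
  exact ⟨φ, DFunLike.congr_fun h⟩

theorem linearization (d n : ℕ) [NeZero d] (hd : 2 ≤ d) (hn : 1 ≤ n)
    (lam0 : V (dp d) n → ZMod (dp d)) (φ0 : V (dp d) n → V (dp d) n)
    (hadd : ∀ v w : V (dp d) n,
      reduceV d n (φ0 (v + w)) = reduceV d n (φ0 v) + reduceV d n (φ0 w)) :
    ∃ (lam : V (dp d) n → ZMod (dp d)) (φ : V (dp d) n →ₗ[ZMod (dp d)] V (dp d) n),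
      ∀ v : V (dp d) n,
        tau d ^ (lam0 v).val • Delta d n (φ0 v) = tau d ^ (lam v).val • Delta d n (φ v) := by
  obtain ⟨φ, hφ⟩ := exists_linearMap_reduceV_eq d n φ0 hadd
  refine ⟨fun v => lam0 v + dotp (φ0 v).1 (φ0 v).2 - dotp (φ v).1 (φ v).2, φ, fun v => ?_⟩
  simp only [Delta, smul_smul, ← tau_pow_val_add, sub_add_cancel, hφ]

end PaperPCl
end
end
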